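/- The quaternion group Q₈ of order 8 is not (1 | 2,2)-generated; that is, there do not exist elements ℓ₁, ℓ₂, h₁, h₂ ∈ Q₈ with ℓ₁ and ℓ₂ of order 2, ℓ₁ℓ₂ · h₁h₂h₁⁻¹h₂⁻¹ = 1, and {ℓ₁, ℓ₂, h₁, h₂} generating Q₈. -/

import Mathlib

lemma q8_central : ∀ l : QuaternionGroup 2, l * l = 1 → ∀ g, l * g = g * l := by decide

lemma q8_invol : ∀ l m : QuaternionGroup 2, l * l = 1 → l ≠ 1 → m * m = 1 → m ≠ 1 →
    l * m = 1 := by decide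

lemma q8_noncomm : ¬ ∀ x y : QuaternionGroup 2, x * y = y * x := by decide

/-- The quaternion group `Q₈` is not `(1 | 2,2)`-generated. -/
theorem quaternionGroup_not_one_two_two_generated :
    ¬ ∃ l₁ l₂ h₁ h₂ : QuaternionGroup 2,
        orderOf l₁ = 2 ∧ orderOf l₂ = 2 ∧
        l₁ * l₂ * (h₁ * h₂ * h₁⁻¹ * h₂⁻¹) = 1 ∧
        Subgroup.closure ({l₁, l₂, h₁, h₂} : Set (QuaternionGroup 2)) = ⊤ := by
  rintro ⟨l₁, l₂, h₁, h₂, o₁, o₂, hr, hc⟩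
  have key : ∀ l : QuaternionGroup 2, orderOf l = 2 → l * l = 1 ∧ l ≠ 1 := by
    intro l hl
    refine ⟨?_, ?_⟩
    · have h := pow_orderOf_eq_one l
      rwa [hl, pow_two] at h
    · rintro rfl
      simp at hl
  obtain ⟨s₁, n₁⟩ := key l₁ o₁
  obtain ⟨s₂, n₂⟩ := key l₂ o₂
  rw [q8_invol l₁ l₂ s₁ n₁ s₂ n₂, one_mul, mul_inv_eq_one, mul_inv_eq_iff_eq_mul] at hr
  have c₁ := q8_central l₁ s₁
  have c₂ := q8_central l₂ s₂
  have hS : ∀ x ∈ ({l₁, l₂, h₁, h₂} : Set (QuaternionGroup 2)),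
      ∀ y ∈ ({l₁, l₂, h₁, h₂} : Set (QuaternionGroup 2)), x * y = y * x := by
    simp only [Set.mem_insert_iff, Set.mem_singleton_iff]
    rintro x (rfl | rfl | rfl | rfl) y (rfl | rfl | rfl | rfl) <;>
      first | rfl | exact c₁ _ | exact c₂ _ | exact (c₁ _).symm | exact (c₂ _).symm
            | exact hr | exact hr.symm
  apply q8_noncomm
  intro x y
  have hx : x ∈ Subgroup.closure ({l₁, l₂, h₁, h₂} : Set (QuaternionGroup 2)) := hc ▸ trivial
  have hy : y ∈ Subgroup.closure ({l₁, l₂, h₁, h₂} : Set (QuaternionGroup 2)) := hc ▸ trivial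
  have := Subgroup.isMulCommutative_closure hS
  exact congrArg Subtype.val (this.is_comm.comm ⟨x, hx⟩ ⟨y, hy⟩)
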